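/- Every finite point set S ⊂ ℝ² in general position (no three collinear) with |S| ≥ 3 admits a triangulation T such that every point p ∈ S has an incident angle of size at least 2π/3; that is, triangulations are 2π/3-open. -/

import Mathlib

open scoped Classical
open EuclideanGeometry

noncomputable section

abbrev Pt := EuclideanSpace ℝ (Fin 2)

/-- No three points of `S` are collinear. -/
def GenPos (S : Finset Pt) : Prop :=
  ∀ p ∈ S, ∀ q ∈ S, ∀ r ∈ S, p ≠ q → p ≠ r → q ≠ r →
    ¬ Collinear ℝ ({p, q, r} : Set Pt)

/-- A plane straight-line graph on the finite point set `S`: vertices are points of `S`,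
edges are recorded as ordered pairs closed under swapping, and two edges that are not
the same unordered pair may only meet at common endpoints. -/
structure PSLG (S : Finset Pt) where
  E : Finset (Pt × Pt)
  symm : ∀ e ∈ E, (e.2, e.1) ∈ E
  endpts : ∀ e ∈ E, e.1 ∈ S ∧ e.2 ∈ S
  ne : ∀ e ∈ E, e.1 ≠ e.2
  noncross : ∀ e ∈ E, ∀ f ∈ E, e ≠ f → e ≠ (f.2, f.1) →
    ∀ x, x ∈ segment ℝ e.1 e.2 → x ∈ segment ℝ f.1 f.2 →
      (x = e.1 ∨ x = e.2) ∧ (x = f.1 ∨ x = f.2)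

/-- The degree of the point `p` in `G`. -/
def PSLG.deg {S : Finset Pt} (G : PSLG S) (p : Pt) : ℕ :=
  (G.E.filter fun e => e.1 = p).card

/-- The point `p` has an incident angle of size at least `φ` in `G`: all edge directions
at `p` fit in a closed cone of half-angle `π - φ / 2` (for `p` of degree ≤ 1 the maximum
incident angle is `2π`, and this condition holds trivially). -/
def VertexOpen {S : Finset Pt} (G : PSLG S) (p : Pt) (φ : ℝ) : Prop :=
  ∃ d : Pt, d ≠ 0 ∧ ∀ q : Pt, (p, q) ∈ G.E →
    InnerProductGeometry.angle d (q - p) ≤ Real.pi - φ / 2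

/-- `G` is `φ`-open: every vertex has an incident angle of size at least `φ`. -/
def PSLG.IsPhiOpen {S : Finset Pt} (G : PSLG S) (φ : ℝ) : Prop :=
  ∀ p ∈ S, VertexOpen G p φ

/-- `G` is connected on `S`. -/
def PSLG.Connected {S : Finset Pt} (G : PSLG S) : Prop :=
  ∀ p ∈ S, ∀ q ∈ S, Relation.ReflTransGen (fun a b => (a, b) ∈ G.E) p q

/-- `G` is a spanning tree of `S`: connected and with the minimum possible number of
edges (each undirected edge is recorded twice). -/
def PSLG.IsSpanningTree {S : Finset Pt} (G : PSLG S) : Prop :=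
  G.Connected ∧ G.E.card = 2 * (S.card - 1)

/-- `G` is a (non-crossing Hamiltonian) spanning path of `S`: a spanning tree of maximum
vertex degree at most two. -/
def PSLG.IsSpanningPath {S : Finset Pt} (G : PSLG S) : Prop :=
  G.IsSpanningTree ∧ ∀ p ∈ S, G.deg p ≤ 2

/-- `S` is in convex position. -/
def ConvexPos (S : Finset Pt) : Prop :=
  ∀ p ∈ S, p ∉ convexHull ℝ (↑(S.erase p) : Set Pt)

/-- `G` is a triangulation of `S`: a maximal plane straight-line graph, i.e. any further
edge between points of `S` would cross the existing graph. -/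
def PSLG.IsTriangulation {S : Finset Pt} (G : PSLG S) : Prop :=
  ∀ p ∈ S, ∀ q ∈ S, p ≠ q → (p, q) ∉ G.E →
    ∃ e ∈ G.E, ∃ x, x ∈ segment ℝ p q ∧ x ∈ segment ℝ e.1 e.2 ∧
      ¬((x = p ∨ x = q) ∧ (x = e.1 ∨ x = e.2))

end

/-- Twice the signed area of the triangle `a b c`. -/
def orient (a b c : Pt) : ℝ := (b 0 - a 0) * (c 1 - a 1) - (b 1 - a 1) * (c 0 - a 0)

/-- The inner product of `a - p` and `b - p`. -/
def dotAt (p a b : Pt) : ℝ := (a 0 - p 0) * (b 0 - p 0) + (a 1 - p 1) * (b 1 - p 1)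

/-- Some line through `p` has all of `S` on one closed side. -/
def Supported (S : Finset Pt) (p : Pt) : Prop :=
  ∃ l m : ℝ, (l ≠ 0 ∨ m ≠ 0) ∧ ∀ q ∈ S, 0 ≤ l * (q 0 - p 0) + m * (q 1 - p 1)

/-- `p` is the apex of a triangle with edges in `E` that contains no further point of `S` and
whose angle at `p` is at least `2π/3`. -/
def Guarded (S : Finset Pt) (E : Finset (Pt × Pt)) (p : Pt) : Prop :=
  ∃ a b : Pt, (p, a) ∈ E ∧ (p, b) ∈ E ∧ (a, b) ∈ E ∧ 0 < orient a b p ∧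
    √3 * dotAt p a b + orient a b p ≤ 0 ∧
    ∀ s ∈ S, 0 ≤ orient a b s → 0 ≤ orient b p s → 0 ≤ orient p a s → s = a ∨ s = b ∨ s = p

lemma Pt.ext' {a b : Pt} (h0 : a 0 = b 0) (h1 : a 1 = b 1) : a = b := by
  ext i
  fin_cases i <;> assumption

lemma GenPos.mono {S T : Finset Pt} (h : GenPos S) (hT : T ⊆ S) : GenPos T :=
  fun p hp q hq r hr => h p (hT hp) q (hT hq) r (hT hr)

lemma exists_eq_mul_of_cross_eq {b0 b1 c0 c1 : ℝ} (hb : b0 ≠ 0 ∨ b1 ≠ 0)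
    (h : b0 * c1 = b1 * c0) : ∃ t : ℝ, c0 = t * b0 ∧ c1 = t * b1 := by
  rcases hb with hb | hb
  · refine ⟨c0 / b0, by field_simp, ?_⟩
    field_simp
    linarith
  · refine ⟨c1 / b1, ?_, by field_simp⟩
    field_simp
    linarith

lemma GenPos.orient_ne_zero {S : Finset Pt} (h : GenPos S) {a b c : Pt} (ha : a ∈ S) (hb : b ∈ S)
    (hc : c ∈ S) (hab : a ≠ b) (hac : a ≠ c) (hbc : b ≠ c) : orient a b c ≠ 0 := by
  intro h0
  apply h a ha b hb c hc hab hac hbc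
  rw [collinear_iff_of_mem (p₀ := a) (by simp)]
  refine ⟨b - a, ?_⟩
  have hne : b 0 - a 0 ≠ 0 ∨ b 1 - a 1 ≠ 0 := by
    by_contra! h
    exact hab (Pt.ext' (by linarith) (by linarith))
  obtain ⟨t, ht0, ht1⟩ := exists_eq_mul_of_cross_eq hne (sub_eq_zero.1 h0)
  rintro p (rfl | rfl | rfl)
  · exact ⟨0, by simp⟩
  · exact ⟨1, by simp⟩
  · exact ⟨t, Pt.ext' (by simpa using sub_eq_iff_eq_add.1 ht0)
      (by simpa using sub_eq_iff_eq_add.1 ht1)⟩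

lemma GenPos.eq_or_eq_of_orient_eq_zero {S : Finset Pt} (h : GenPos S) {a b c : Pt} (ha : a ∈ S)
    (hb : b ∈ S) (hc : c ∈ S) (hab : a ≠ b) (h0 : orient a b c = 0) : c = a ∨ c = b := by
  by_contra! hne
  exact h.orient_ne_zero ha hb hc hab hne.1.symm hne.2.symm h0

lemma GenPos.orient_pos {S : Finset Pt} (h : GenPos S) {a b c : Pt} (ha : a ∈ S)
    (hb : b ∈ S) (hc : c ∈ S) (hab : a ≠ b) (hca : c ≠ a) (hcb : c ≠ b) (h0 : 0 ≤ orient a b c) :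
    0 < orient a b c :=
  lt_of_le_of_ne h0 (h.orient_ne_zero ha hb hc hab hca.symm hcb.symm).symm

lemma exists_coords_of_mem_segment {a b x : Pt} (h : x ∈ segment ℝ a b) :
    ∃ s t : ℝ, 0 ≤ s ∧ 0 ≤ t ∧ s + t = 1 ∧ x 0 = s * a 0 + t * b 0 ∧ x 1 = s * a 1 + t * b 1 := by
  obtain ⟨s, t, hs, ht, hst, rfl⟩ := h
  exact ⟨s, t, hs, ht, hst, by simp, by simp⟩

lemma orient_nonneg_of_mem_segment {u v a b x : Pt} (hx : x ∈ segment ℝ a b)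
    (ha : 0 ≤ orient u v a) (hb : 0 ≤ orient u v b) : 0 ≤ orient u v x := by
  obtain ⟨s, t, hs, ht, hst, h0, h1⟩ := exists_coords_of_mem_segment hx
  have : orient u v x = s * orient u v a + t * orient u v b := by
    unfold orient
    rw [h0, h1]
    obtain rfl : s = 1 - t := by linarith
    ring
  rw [this]
  positivity

lemma eq_endpoint_of_orient_eq_zero {u v a b x : Pt} (hx : x ∈ segment ℝ a b)
    (ha : 0 ≤ orient u v a) (hb : 0 ≤ orient u v b) (h : orient u v x = 0) :
    (x = a ∧ orient u v a = 0) ∨ (x = b ∧ orient u v b = 0) ∨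
      (orient u v a = 0 ∧ orient u v b = 0) := by
  obtain ⟨s, t, hs, ht, hst, h0, h1⟩ := exists_coords_of_mem_segment hx
  have e : orient u v x = s * orient u v a + t * orient u v b := by
    unfold orient
    rw [h0, h1]
    obtain rfl : s = 1 - t := by linarith
    ring
  have h2 : s * orient u v a = 0 := by nlinarith [mul_nonneg hs ha, mul_nonneg ht hb]
  have h3 : t * orient u v b = 0 := by nlinarith [mul_nonneg hs ha, mul_nonneg ht hb]
  rcases mul_eq_zero.1 h2 with rfl | h2
  · obtain rfl : t = 1 := by linarith
    refine .inr (.inl ⟨Pt.ext' (by simpa using h0) (by simpa using h1), by simpa using h3⟩)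
  · rcases mul_eq_zero.1 h3 with rfl | h3
    · obtain rfl : s = 1 := by linarith
      exact .inl ⟨Pt.ext' (by simpa using h0) (by simpa using h1), by simpa using h2⟩
    · exact .inr (.inr ⟨h2, h3⟩)

/-- A plane graph extends to a triangulation. -/
lemma PSLG.exists_triangulation_extending {S : Finset Pt} (G : PSLG S) :
    ∃ T : PSLG S, G.E ⊆ T.E ∧ T.IsTriangulation := by
  let F := (S ×ˢ S).powerset.filter fun E => ∃ T : PSLG S, T.E = E ∧ G.E ⊆ E
  have sub (T : PSLG S) : T.E ⊆ S ×ˢ S := fun e he => Finset.mem_product.2 (T.endpts e he)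
  have hF : F.Nonempty := ⟨G.E, by simp [F, sub G]⟩
  obtain ⟨E, hE, hmax⟩ := F.exists_max_image Finset.card hF
  obtain ⟨T, rfl, hGT⟩ := (Finset.mem_filter.1 hE).2
  refine ⟨T, hGT, ?_⟩
  intro p hp q hq hpq hnot
  by_contra! hcon
  let Tpq : PSLG S :=
    { E := insert (p, q) (insert (q, p) T.E)
      symm := by
        intro e he
        simp only [Finset.mem_insert] at he ⊢
        rcases he with rfl | rfl | he
        · simp
        · simp
        · exact .inr (.inr (T.symm e he))
      endpts := by
        intro e he
        simp only [Finset.mem_insert] at he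
        rcases he with rfl | rfl | he
        · exact ⟨hp, hq⟩
        · exact ⟨hq, hp⟩
        · exact T.endpts e he
      ne := by
        intro e he
        simp only [Finset.mem_insert] at he
        rcases he with rfl | rfl | he
        · exact hpq
        · exact hpq.symm
        · exact T.ne e he
      noncross := by
        intro e he f hf hef hef' x hx hx'
        simp only [Finset.mem_insert] at he hf
        rcases he with rfl | rfl | he <;> rcases hf with rfl | rfl | hf
        · exact absurd rfl hef
        · exact absurd rfl hef'
        · exact hcon f hf x hx hx'
        · exact absurd rfl hef'
        · exact absurd rfl hef
        · rw [segment_symm] at hx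
          exact (hcon f hf x hx hx').imp_left Or.symm
        · exact (hcon e he x hx' hx).symm
        · rw [segment_symm] at hx'
          exact (hcon e he x hx' hx).symm.imp_right Or.symm
        · exact T.noncross e he f hf hef hef' x hx hx' }
  have hsub : T.E ⊆ Tpq.E := fun e he => by simp [Tpq, he]
  have h1 := hmax Tpq.E (Finset.mem_filter.2
    ⟨Finset.mem_powerset.2 (sub Tpq), Tpq, rfl, hGT.trans hsub⟩)
  have h2 : T.E = Tpq.E := Finset.eq_of_subset_of_card_le hsub h1
  exact hnot (h2 ▸ by simp [Tpq])

/-- A triangulation contains every edge of the convex hull. -/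
lemma PSLG.IsTriangulation.mem_of_orient_nonneg {S : Finset Pt} (hS : GenPos S) {T : PSLG S}
    (hT : T.IsTriangulation) {u v : Pt} (hu : u ∈ S) (hv : v ∈ S) (huv : u ≠ v)
    (h : ∀ s ∈ S, 0 ≤ orient u v s) : (u, v) ∈ T.E := by
  by_contra hnot
  obtain ⟨e, he, x, hx, hxe, hne⟩ := hT u hu v hv huv hnot
  apply hne
  obtain ⟨h1, h2⟩ := T.endpts e he
  have h0 : orient u v x = 0 := by
    obtain ⟨s, t, hs, ht, hst, h0, h1⟩ := exists_coords_of_mem_segment hx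
    unfold orient
    rw [h0, h1]
    obtain rfl : s = 1 - t := by linarith
    ring
  have key {c : Pt} (hc : c ∈ S) (h : orient u v c = 0) :=
    hS.eq_or_eq_of_orient_eq_zero hu hv hc huv h
  rcases eq_endpoint_of_orient_eq_zero hxe (h _ h1) (h _ h2) h0 with ⟨hx, h⟩ | ⟨hx, h⟩ | ⟨h, h'⟩
  · exact ⟨hx ▸ key h1 h, .inl hx⟩
  · exact ⟨hx ▸ key h2 h, .inr hx⟩
  · exfalso
    have hn := T.ne e he
    have hs := T.symm e he
    rcases key h1 h with h1 | h1 <;> rcases key h2 h' with h2 | h2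
    · exact hn (h1.trans h2.symm)
    · exact hnot (by rw [← h1, ← h2]; exact he)
    · exact hnot (by rw [← h1, ← h2]; exact hs)
    · exact hn (h1.trans h2.symm)

lemma orient_swap (u v s : Pt) : orient v u s = - orient u v s := by
  unfold orient
  ring

lemma orient_rotate (a b c : Pt) : orient b c a = orient a b c := by
  unfold orient
  ring

/-- Plane graphs on the two sides of a line through two points of `S` fit together. -/
lemma exists_triangulation_of_halves {S : Finset Pt} (hS : GenPos S) {u v : Pt} (hu : u ∈ S)
    (hv : v ∈ S) (huv : u ≠ v) (G₁ : PSLG (S.filter fun s => 0 ≤ orient u v s))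
    (G₂ : PSLG (S.filter fun s => 0 ≤ orient v u s)) :
    ∃ T : PSLG S, G₁.E ⊆ T.E ∧ G₂.E ⊆ T.E ∧ T.IsTriangulation := by
  have e1 := fun e he => (G₁.endpts e he).imp Finset.mem_filter.1 Finset.mem_filter.1
  have e2 := fun e he => (G₂.endpts e he).imp Finset.mem_filter.1 Finset.mem_filter.1
  have key {c : Pt} (hc : c ∈ S) (h : orient u v c = 0) :=
    hS.eq_or_eq_of_orient_eq_zero hu hv hc huv h
  have cross : ∀ e ∈ G₁.E, ∀ f ∈ G₂.E, e ≠ f → e ≠ (f.2, f.1) →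
      ∀ x, x ∈ segment ℝ e.1 e.2 → x ∈ segment ℝ f.1 f.2 →
      (x = e.1 ∨ x = e.2) ∧ (x = f.1 ∨ x = f.2) := by
    intro e he f hf hef hef' x hxe hxf
    obtain ⟨⟨a1, b1⟩, ⟨a2, b2⟩⟩ := e1 e he
    obtain ⟨⟨c1, d1⟩, ⟨c2, d2⟩⟩ := e2 f hf
    have g1 := orient_nonneg_of_mem_segment hxe b1 b2
    have g2 := orient_nonneg_of_mem_segment hxf d1 d2
    have z : orient u v x = 0 := by linarith [orient_swap u v x]
    have z' : orient v u x = 0 := by linarith [orient_swap u v x]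
    have key' {c : Pt} (hc : c ∈ S) (h : orient v u c = 0) :=
      key hc (by linarith [orient_swap u v c])
    have l1 : (x = e.1 ∨ x = e.2) ∧ (x = u ∨ x = v) ∨ (e = (u, v) ∨ e = (v, u)) := by
      rcases eq_endpoint_of_orient_eq_zero hxe b1 b2 z with ⟨hx, h⟩ | ⟨hx, h⟩ | ⟨h, h'⟩
      · exact .inl ⟨.inl hx, hx ▸ key a1 h⟩
      · exact .inl ⟨.inr hx, hx ▸ key a2 h⟩
      · have hn := G₁.ne e he
        have := key a1 h
        have := key a2 h'
        right
        obtain ⟨y, w⟩ := e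
        simp only [Prod.mk.injEq] at *
        grind
    have l2 : (x = f.1 ∨ x = f.2) ∧ (x = u ∨ x = v) ∨ (f = (u, v) ∨ f = (v, u)) := by
      rcases eq_endpoint_of_orient_eq_zero hxf d1 d2 z' with ⟨hx, h⟩ | ⟨hx, h⟩ | ⟨h, h'⟩
      · exact .inl ⟨.inl hx, hx ▸ key' c1 h⟩
      · exact .inl ⟨.inr hx, hx ▸ key' c2 h⟩
      · have hn := G₂.ne f hf
        have := key' c1 h
        have := key' c2 h'
        right
        obtain ⟨y, w⟩ := f
        simp only [Prod.mk.injEq] at *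
        grind
    obtain ⟨y, w⟩ := e
    obtain ⟨y', w'⟩ := f
    simp only [Prod.mk.injEq, ne_eq] at *
    clear * - l1 l2 hef hef'
    grind
  let T : PSLG S :=
    { E := G₁.E ∪ G₂.E
      symm := by
        intro e he
        rcases Finset.mem_union.1 he with he | he
        · exact Finset.mem_union_left _ (G₁.symm e he)
        · exact Finset.mem_union_right _ (G₂.symm e he)
      endpts := by
        intro e he
        rcases Finset.mem_union.1 he with he | he
        · exact ⟨(e1 e he).1.1, (e1 e he).2.1⟩
        · exact ⟨(e2 e he).1.1, (e2 e he).2.1⟩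
      ne := by
        intro e he
        rcases Finset.mem_union.1 he with he | he
        · exact G₁.ne e he
        · exact G₂.ne e he
      noncross := by
        intro e he f hf hef hef' x hx hx'
        rcases Finset.mem_union.1 he with he | he <;> rcases Finset.mem_union.1 hf with hf | hf
        · exact G₁.noncross e he f hf hef hef' x hx hx'
        · exact cross e he f hf hef hef' x hx hx'
        · exact (cross f hf e he hef.symm (fun h => hef' (by rw [h])) x hx' hx).symm
        · exact G₂.noncross e he f hf hef hef' x hx hx' }
  obtain ⟨T', hT, hT'⟩ := T.exists_triangulation_extending
  exact ⟨T', Finset.subset_union_left.trans hT, Finset.subset_union_right.trans hT, hT'⟩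

lemma Guarded.mono {S : Finset Pt} {E E' : Finset (Pt × Pt)} {p : Pt} (h : Guarded S E p)
    (hE : E ⊆ E') : Guarded S E' p := by
  obtain ⟨a, b, h1, h2, h3, h⟩ := h
  exact ⟨a, b, hE h1, hE h2, hE h3, h⟩

/-- Barycentric coordinates: the value of an affine form at `s` in terms of those at `a b c`. -/
lemma orient_mul_affine (a b c s : Pt) (l m k : ℝ) :
    orient a b c * (l * s 0 + m * s 1 + k) =
      orient b c s * (l * a 0 + m * a 1 + k) + orient c a s * (l * b 0 + m * b 1 + k) +
        orient a b s * (l * c 0 + m * c 1 + k) := by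
  unfold orient
  ring

lemma orient_mul_orient (a b c s u v : Pt) :
    orient a b c * orient u v s =
      orient b c s * orient u v a + orient c a s * orient u v b + orient a b s * orient u v c := by
  unfold orient
  ring

/-- A guard relative to one side of a line is a guard relative to all of `S`. -/
lemma Guarded.of_half {S : Finset Pt} {u v p : Pt}
    {G : PSLG (S.filter fun s => 0 ≤ orient u v s)}
    (h : Guarded (S.filter fun s => 0 ≤ orient u v s) G.E p) : Guarded S G.E p := by
  obtain ⟨a, b, h1, h2, h3, hpos, hang, h⟩ := h
  refine ⟨a, b, h1, h2, h3, hpos, hang, fun s hs s1 s2 s3 => h s ?_ s1 s2 s3⟩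
  refine Finset.mem_filter.2 ⟨hs, ?_⟩
  have hp := (Finset.mem_filter.1 (G.endpts _ h1).1).2
  have ha := (Finset.mem_filter.1 (G.endpts _ h1).2).2
  have hb := (Finset.mem_filter.1 (G.endpts _ h2).2).2
  dsimp only at hp ha hb
  have := orient_mul_orient a b p s u v
  refine nonneg_of_mul_nonneg_right (a := orient a b p) ?_ hpos
  rw [this]
  positivity

lemma not_supported_of_orient_pos {S : Finset Pt} {a b c p : Pt} (ha : a ∈ S) (hb : b ∈ S)
    (hc : c ∈ S) (h1 : 0 < orient a b p) (h2 : 0 < orient b c p) (h3 : 0 < orient c a p) :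
    ¬ Supported S p := by
  rintro ⟨l, m, hlm, h⟩
  have e := orient_mul_affine a b c p l m (-(l * p 0 + m * p 1))
  have ka := h a ha
  have kb := h b hb
  have kc := h c hc
  have za : l * (a 0 - p 0) + m * (a 1 - p 1) = 0 := by
    have := mul_nonneg h2.le ka
    have := mul_nonneg h3.le kb
    have := mul_nonneg h1.le kc
    have : orient b c p * (l * (a 0 - p 0) + m * (a 1 - p 1)) = 0 := by linarith
    exact (mul_eq_zero.1 this).resolve_left h2.ne'
  have zb : l * (b 0 - p 0) + m * (b 1 - p 1) = 0 := by
    have := mul_nonneg h2.le ka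
    have := mul_nonneg h3.le kb
    have := mul_nonneg h1.le kc
    have : orient c a p * (l * (b 0 - p 0) + m * (b 1 - p 1)) = 0 := by linarith
    exact (mul_eq_zero.1 this).resolve_left h3.ne'
  have d : orient a b p =
      (a 0 - p 0) * (b 1 - p 1) - (a 1 - p 1) * (b 0 - p 0) := by
    unfold orient
    ring
  have hl : l * orient a b p = 0 := by
    rw [d]
    linear_combination (b 1 - p 1) * za - (a 1 - p 1) * zb
  have hm : m * orient a b p = 0 := by
    rw [d]
    linear_combination (a 0 - p 0) * zb - (b 0 - p 0) * za
  rcases hlm with hlm | hlm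
  · exact hlm ((mul_eq_zero.1 hl).resolve_right h1.ne')
  · exact hlm ((mul_eq_zero.1 hm).resolve_right h1.ne')

lemma supported_of_orient_nonneg {S : Finset Pt} {a b p : Pt} (hab : a ≠ b)
    (h : ∀ s ∈ S, 0 ≤ orient a b s) (hp : orient a b p = 0) : Supported S p := by
  refine ⟨-(b 1 - a 1), b 0 - a 0, ?_, fun q hq => ?_⟩
  · by_contra! h
    exact hab (Pt.ext' (by linarith) (by linarith))
  · have := h q hq
    unfold orient at this hp
    linarith

lemma orient_self_left (a b : Pt) : orient a b a = 0 := by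
  unfold orient
  ring

lemma orient_self_right (a b : Pt) : orient a b b = 0 := by
  unfold orient
  ring

/-- A line `uv` leaves the convex hull at a supported point `u`: no convex combination of points
`p`, `q` of `S` off the line lies on it beyond `u`. -/
lemma Supported.not_beyond {S : Finset Pt} {u v p q : Pt} (hu : Supported S u) (hv : v ∈ S)
    (hp : p ∈ S) (hq : q ∈ S) (hfp : orient u v p ≠ 0) {x y t : ℝ} (hx : 0 < x) (hy : 0 ≤ y)
    (ht : t < 0) (h0 : x * (p 0 - u 0) + y * (q 0 - u 0) = t * (v 0 - u 0))
    (h1 : x * (p 1 - u 1) + y * (q 1 - u 1) = t * (v 1 - u 1)) : False := by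
  obtain ⟨l, m, hlm, h⟩ := hu
  have kp := h p hp
  have kq := h q hq
  have kv := h v hv
  have e : x * (l * (p 0 - u 0) + m * (p 1 - u 1)) + y * (l * (q 0 - u 0) + m * (q 1 - u 1)) =
      t * (l * (v 0 - u 0) + m * (v 1 - u 1)) := by
    linear_combination l * h0 + m * h1
  have ep := mul_nonneg hx.le kp
  have eq := mul_nonneg hy kq
  have zv : l * (v 0 - u 0) + m * (v 1 - u 1) = 0 := by
    by_contra hne
    have := mul_neg_of_neg_of_pos ht (lt_of_le_of_ne kv (Ne.symm hne))
    linarith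
  have zp : l * (p 0 - u 0) + m * (p 1 - u 1) = 0 := by
    rw [zv, mul_zero] at e
    have : x * (l * (p 0 - u 0) + m * (p 1 - u 1)) = 0 := by linarith
    exact (mul_eq_zero.1 this).resolve_left hx.ne'
  have hl : l * orient u v p = 0 := by
    unfold orient
    linear_combination (p 1 - u 1) * zv - (v 1 - u 1) * zp
  have hm : m * orient u v p = 0 := by
    unfold orient
    linear_combination (v 0 - u 0) * zp - (p 0 - u 0) * zv
  rcases hlm with hlm | hlm
  · exact hlm ((mul_eq_zero.1 hl).resolve_right hfp)
  · exact hlm ((mul_eq_zero.1 hm).resolve_right hfp)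

/-- If `u` and `v` are supported, cutting along `uv` creates no new supported points. -/
lemma Supported.of_half {S : Finset Pt} {u v p : Pt} (hu : Supported S u) (hv : Supported S v)
    (huS : u ∈ S) (hvS : v ∈ S) (huv : u ≠ v) (hp : p ∈ S) (hfp : 0 < orient u v p)
    (h : Supported (S.filter fun s => 0 ≤ orient u v s) p) : Supported S p := by
  obtain ⟨l, m, hlm, h⟩ := h
  refine ⟨l, m, hlm, fun q hq => ?_⟩
  by_contra! hLq
  have hfq : orient u v q < 0 := by
    by_contra! hfq
    exact absurd (h q (Finset.mem_filter.2 ⟨hq, hfq⟩)) (not_le.2 hLq)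
  have hLu := h u (Finset.mem_filter.2 ⟨huS, (orient_self_left u v).ge⟩)
  have hLv := h v (Finset.mem_filter.2 ⟨hvS, (orient_self_right u v).ge⟩)
  set P := orient u v p with hP
  set Q := -orient u v q with hQ
  have hQ0 : 0 < Q := by linarith
  have hz : (v 0 - u 0) * (Q * (p 1 - u 1) + P * (q 1 - u 1)) =
      (v 1 - u 1) * (Q * (p 0 - u 0) + P * (q 0 - u 0)) := by
    rw [hP, hQ]
    unfold orient
    ring
  have hne : v 0 - u 0 ≠ 0 ∨ v 1 - u 1 ≠ 0 := by
    by_contra! h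
    exact huv (Pt.ext' (by linarith) (by linarith))
  obtain ⟨t, h0, h1⟩ := exists_eq_mul_of_cross_eq hne hz
  have e : P * (l * (q 0 - p 0) + m * (q 1 - p 1)) =
      (P + Q - t) * (l * (u 0 - p 0) + m * (u 1 - p 1)) + t * (l * (v 0 - p 0) + m * (v 1 - p 1)) := by
    linear_combination l * h0 + m * h1
  have e' := mul_neg_of_pos_of_neg hfp hLq
  have ht : t < 0 ∨ P + Q < t := by
    by_contra! ht
    have := mul_nonneg ht.1 hLv
    have := mul_nonneg (sub_nonneg.2 ht.2) hLu
    linarith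
  rcases ht with ht | ht
  · exact hu.not_beyond hvS hp hq hfp.ne' hQ0 hfp.le ht h0 h1
  · refine hv.not_beyond (t := P + Q - t) huS hp hq ?_ hQ0 hfp.le (by linarith) ?_ ?_
    · rw [orient_swap]
      exact neg_ne_zero.2 hfp.ne'
    · linear_combination h0
    · linear_combination h1

lemma dotAt_convex {a b c s : Pt} {α β γ k : ℝ} (hα : 0 ≤ α) (hβ : 0 ≤ β) (hγ : 0 ≤ γ)
    (hs : α + β + γ = 1) (h0 : s 0 = α * a 0 + β * b 0 + γ * c 0)
    (h1 : s 1 = α * a 1 + β * b 1 + γ * c 1) (hk : 0 ≤ k)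
    (hc : k * dotAt c a b + orient a b c ≤ 0) : k * dotAt s a b + orient a b s ≤ 0 := by
  obtain rfl : α = 1 - β - γ := by linarith
  have e1 : orient a b s = γ * orient a b c := by
    unfold orient
    rw [h0, h1]
    ring
  have e2 : dotAt s a b = γ * dotAt c a b - ((1 - β - γ) * β * ((a 0 - b 0) ^ 2 + (a 1 - b 1) ^ 2)
      + (1 - β - γ) * γ * ((a 0 - c 0) ^ 2 + (a 1 - c 1) ^ 2)
      + β * γ * ((b 0 - c 0) ^ 2 + (b 1 - c 1) ^ 2)) := by
    unfold dotAt
    rw [h0, h1]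
    ring
  have e3 : 0 ≤ (1 - β - γ) * β * ((a 0 - b 0) ^ 2 + (a 1 - b 1) ^ 2)
      + (1 - β - γ) * γ * ((a 0 - c 0) ^ 2 + (a 1 - c 1) ^ 2)
      + β * γ * ((b 0 - c 0) ^ 2 + (b 1 - c 1) ^ 2) := by positivity
  rw [e1, e2]
  nlinarith [mul_nonneg hk e3, mul_nonneg hγ (sub_nonneg.2 hc)]

lemma exists_wide_angle_aux {x0 x1 y0 y1 z0 z1 k C1 C2 C3 : ℝ} (hk : 0 < k) (hk2 : k ^ 2 = 3)
    (e1 : C1 = y0 * z1 - y1 * z0) (e2 : C2 = z0 * x1 - z1 * x0) (e3 : C3 = x0 * y1 - x1 * y0)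
    (h1 : 0 < C1) (h2 : 0 < C2) (h3 : 0 < C3) (d1 : 0 < k * (y0 * z0 + y1 * z1) + C1)
    (d2 : 0 < k * (z0 * x0 + z1 * x1) + C2) (d3 : 0 < k * (x0 * y0 + x1 * y1) + C3) : False := by
  set D := x0 * y0 + x1 * y1 with hD
  set X := x0 ^ 2 + x1 ^ 2 with hX
  set Y := y0 ^ 2 + y1 ^ 2 with hY
  have f1 : C3 * (y0 * z0 + y1 * z1) = -(C1 * D + C2 * Y) := by
    rw [e1, e2, e3]; ring
  have f2 : C3 * (z0 * x0 + z1 * x1) = -(C2 * D + C1 * X) := by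
    rw [e1, e2, e3]; ring
  have g1 : k * C2 * Y < C1 * (C3 - k * D) := by nlinarith [mul_pos h3 d1]
  have g2 : k * C1 * X < C2 * (C3 - k * D) := by nlinarith [mul_pos h3 d2]
  have hY0 : 0 ≤ Y := by positivity
  have hX0 : 0 ≤ X := by positivity
  have hXY : X * Y = D ^ 2 + C3 ^ 2 := by rw [e3]; ring
  have g3 : (k * C2 * Y) * (k * C1 * X) < (C1 * (C3 - k * D)) * (C2 * (C3 - k * D)) :=
    mul_lt_mul'' g1 g2 (by positivity) (by positivity)
  have g4 : C1 * C2 * (3 * (X * Y)) < C1 * C2 * (C3 - k * D) ^ 2 := by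
    rw [← hk2]; linarith
  have g5 := lt_of_mul_lt_mul_left g4 (mul_pos h1 h2).le
  rw [hXY] at g5
  have : 0 < C3 * (k * D + C3) := mul_pos h3 d3
  have : (C3 - k * D) ^ 2 = C3 ^ 2 - 2 * C3 * k * D + 3 * D ^ 2 := by rw [← hk2]; ring
  linarith

/-- A point inside a triangle sees one of the three sides at an angle of at least `2π/3`. -/
lemma exists_wide_angle {a b c p : Pt} (h1 : 0 < orient a b p) (h2 : 0 < orient b c p)
    (h3 : 0 < orient c a p) : √3 * dotAt p a b + orient a b p ≤ 0 ∨
      √3 * dotAt p b c + orient b c p ≤ 0 ∨ √3 * dotAt p c a + orient c a p ≤ 0 := by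
  by_contra! h
  obtain ⟨d1, d2, d3⟩ := h
  refine exists_wide_angle_aux (x0 := a 0 - p 0) (x1 := a 1 - p 1) (y0 := b 0 - p 0)
    (y1 := b 1 - p 1) (z0 := c 0 - p 0) (z1 := c 1 - p 1) (k := √3) (by positivity)
    (Real.sq_sqrt (by norm_num)) ?_ ?_ ?_ h2 h3 h1 d2 d3 d1 <;>
  · unfold orient
    ring

lemma angle_le_of_dotAt {d v : Pt} (hd : d ≠ 0) (hv : v ≠ 0)
    (h : -(‖d‖ * ‖v‖) ≤ 2 * inner ℝ d v) :
    InnerProductGeometry.angle d v ≤ Real.pi - (2 * Real.pi / 3) / 2 := by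
  have e : Real.pi - (2 * Real.pi / 3) / 2 = Real.arccos (-(1 / 2)) := by
    rw [Real.arccos_neg, ← Real.cos_pi_div_three,
      Real.arccos_cos (by positivity) (by linarith [Real.pi_pos])]
    ring
  rw [e, InnerProductGeometry.angle]
  apply Real.arccos_le_arccos
  have := norm_pos_iff.2 hd
  have := norm_pos_iff.2 hv
  rw [le_div_iff₀ (by positivity)]
  linarith

lemma cone_aux {X Y D A B : ℝ} (hX : 0 < X) (hY : 0 < Y) (hD : 2 * D ≤ -(X * Y))
    (hD' : 0 < X * Y + D) (α β : ℝ) (hA : A = α * X) (hB : B = β * Y) (hpos : 0 < A + B)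
    (h : 2 * (X * Y) * (X * Y + D) * (α ^ 2 * X ^ 2 + β ^ 2 * Y ^ 2 + 2 * α * β * D) <
      4 * ((X * Y + D) * (A + B)) ^ 2) : 0 < A ∧ 0 < B := by
  have hXY : 0 < X * Y := mul_pos hX hY
  have g1 : (X * Y) * (α ^ 2 * X ^ 2 + β ^ 2 * Y ^ 2 + 2 * α * β * D) <
      2 * (X * Y + D) * (A + B) ^ 2 := by
    apply lt_of_mul_lt_mul_left (a := 2 * (X * Y + D)) _ (by positivity)
    linarith
  have g2 : 2 * (X * Y + D) * (A + B) ^ 2 ≤ (X * Y) * (A + B) ^ 2 := by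
    exact mul_le_mul_of_nonneg_right (by linarith) (sq_nonneg _)
  have g3 : (X * Y) * (α ^ 2 * X ^ 2 + β ^ 2 * Y ^ 2 + 2 * α * β * D) =
      (X * Y) * (A + B) ^ 2 - 2 * (X * Y - D) * (A * B) := by
    rw [hA, hB]; ring
  have g4 : 0 < A * B := by
    have : 0 < (2 * (X * Y - D)) * (A * B) := by linarith
    exact pos_of_mul_pos_right this (by linarith)
  constructor <;> by_contra! hn
  · nlinarith
  · nlinarith

/-- No edge enters the sector of a guarding triangle, which leaves an angle of `2π/3` free. -/
lemma Guarded.vertexOpen {S : Finset Pt} {G : PSLG S} {p : Pt} (h : Guarded S G.E p) :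
    VertexOpen G p (2 * Real.pi / 3) := by
  obtain ⟨a, b, hpa, hpb, hab, hO, hang, hempty⟩ := h
  have hO' : orient a b p = (a 0 - p 0) * (b 1 - p 1) - (a 1 - p 1) * (b 0 - p 0) := by
    unfold orient
    ring
  set D := dotAt p a b with hD
  set X := ‖a - p‖ with hX
  set Y := ‖b - p‖ with hY
  have hX2 : X ^ 2 = (a 0 - p 0) ^ 2 + (a 1 - p 1) ^ 2 := by
    simp [hX, EuclideanSpace.norm_sq_eq, Fin.sum_univ_two]
  have hY2 : Y ^ 2 = (b 0 - p 0) ^ 2 + (b 1 - p 1) ^ 2 := by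
    simp [hY, EuclideanSpace.norm_sq_eq, Fin.sum_univ_two]
  have hX0 : 0 < X := norm_pos_iff.2 (sub_ne_zero.2 (G.ne _ hpa).symm)
  have hY0 : 0 < Y := norm_pos_iff.2 (sub_ne_zero.2 (G.ne _ hpb).symm)
  have hXY : (X * Y) ^ 2 = D ^ 2 + orient a b p ^ 2 := by
    rw [mul_pow, hX2, hY2, hO', hD, dotAt]
    ring
  have h3 : √3 ^ 2 = 3 := Real.sq_sqrt (by norm_num)
  have h30 : 0 < √3 := by positivity
  have hDneg : D < 0 := by
    by_contra! h
    nlinarith [mul_nonneg h30.le h]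
  have hD1 : 2 * D ≤ -(X * Y) := by
    have : orient a b p ^ 2 ≤ (√3 * (-D)) ^ 2 := by
      apply pow_le_pow_left₀ hO.le
      linarith
    rw [mul_pow, h3] at this
    have : (X * Y) ^ 2 ≤ (2 * (-D)) ^ 2 := by
      rw [hXY]
      linarith
    have := le_of_sq_le_sq this (by linarith)
    linarith
  have hD2 : 0 < X * Y + D := by
    have : (-D) ^ 2 < (X * Y) ^ 2 := by
      rw [hXY]
      have := pow_pos hO 2
      linarith
    have := lt_of_pow_lt_pow_left₀ 2 (by positivity) this
    linarith
  set e : Pt := Y • (a - p) + X • (b - p) with he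
  have he0 : e 0 = Y * (a 0 - p 0) + X * (b 0 - p 0) := by simp [he]
  have he1 : e 1 = Y * (a 1 - p 1) + X * (b 1 - p 1) := by simp [he]
  have hee : ‖e‖ ^ 2 = 2 * (X * Y) * (X * Y + D) := by
    rw [EuclideanSpace.norm_sq_eq, Fin.sum_univ_two, Real.norm_eq_abs, Real.norm_eq_abs, sq_abs,
      sq_abs, he0, he1, hD, dotAt]
    linear_combination (-Y ^ 2) * hX2 - X ^ 2 * hY2
  have hene : e ≠ 0 := by
    intro h
    rw [h, norm_zero] at hee
    have := mul_pos (mul_pos hX0 hY0) hD2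
    linarith
  refine ⟨-e, neg_ne_zero.2 hene, fun q hpq => ?_⟩
  refine angle_le_of_dotAt (neg_ne_zero.2 hene) (sub_ne_zero.2 (G.ne _ hpq).symm) ?_
  rw [norm_neg, inner_neg_left]
  by_contra! hcon
  set O := orient a b p with hOdef
  set α := orient b p q / O with hα
  set β := orient p a q / O with hβ
  have q0 : q 0 - p 0 = α * (a 0 - p 0) + β * (b 0 - p 0) := by
    rw [hα, hβ]
    field_simp
    rw [hOdef]
    unfold orient
    ring
  have q1 : q 1 - p 1 = α * (a 1 - p 1) + β * (b 1 - p 1) := by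
    rw [hα, hβ]
    field_simp
    rw [hOdef]
    unfold orient
    ring
  have hin : inner ℝ e (q - p) = (X * Y + D) * (α * X + β * Y) := by
    rw [PiLp.inner_apply, Fin.sum_univ_two]
    simp only [RCLike.inner_apply, conj_trivial, PiLp.sub_apply]
    rw [he0, he1, q0, q1, hD, dotAt]
    linear_combination (-Y * α) * hX2 - X * β * hY2
  have hv2 : ‖q - p‖ ^ 2 = α ^ 2 * X ^ 2 + β ^ 2 * Y ^ 2 + 2 * α * β * D := by
    rw [EuclideanSpace.norm_sq_eq, Fin.sum_univ_two, Real.norm_eq_abs, Real.norm_eq_abs, sq_abs,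
      sq_abs, PiLp.sub_apply, PiLp.sub_apply, q0, q1, hX2, hY2, hD, dotAt]
    ring
  have hcon' : ‖e‖ * ‖q - p‖ < 2 * inner ℝ e (q - p) := by linarith
  have hpos : 0 < α * X + β * Y := by
    have : 0 < (X * Y + D) * (α * X + β * Y) := by
      rw [← hin]
      have : 0 ≤ ‖e‖ * ‖q - p‖ := by positivity
      linarith
    exact pos_of_mul_pos_right this hD2.le
  obtain ⟨hA, hB⟩ := cone_aux hX0 hY0 hD1 hD2 α β rfl rfl hpos (by
    rw [← hee, ← hv2, ← hin, ← mul_pow]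
    have := pow_lt_pow_left₀ hcon' (by positivity) two_ne_zero
    linarith)
  have hα0 : 0 < α := pos_of_mul_pos_left hA hX0.le
  have hβ0 : 0 < β := pos_of_mul_pos_left hB hY0.le
  have hr1 : orient b p q = α * O := by rw [hα]; field_simp
  have hr2 : orient p a q = β * O := by rw [hβ]; field_simp
  have hr1' : 0 < orient b p q := by rw [hr1]; positivity
  have hr2' : 0 < orient p a q := by rw [hr2]; positivity
  have hqa : q ≠ a := by
    rintro rfl
    linarith [orient_self_right p q]
  have hqb : q ≠ b := by
    rintro rfl
    linarith [orient_self_left q p]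
  have hr3 : orient a b q = (1 - α - β) * O := by
    have : orient a b q + orient b p q + orient p a q = O := by
      rw [hOdef]
      unfold orient
      ring
    linarith
  rcases le_or_gt (α + β) 1 with hle | hgt
  · rcases hempty q (G.endpts _ hpq).2 (by rw [hr3]; exact mul_nonneg (by linarith) hO.le)
      hr1'.le hr2'.le with h | h | h
    · exact hqa h
    · exact hqb h
    · exact G.ne _ hpq h.symm
  · have hs : 0 < α + β := by linarith
    set x : Pt := (α / (α + β)) • a + (β / (α + β)) • b with hx
    have hxab : x ∈ segment ℝ a b :=
      ⟨_, _, by positivity, by positivity, by field_simp, rfl⟩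
    have hxpq : x ∈ segment ℝ p q := by
      refine ⟨1 - 1 / (α + β), 1 / (α + β), ?_, by positivity, by ring, ?_⟩
      · rw [sub_nonneg, div_le_one hs]
        exact hgt.le
      · apply Pt.ext'
        · simp only [hx, PiLp.add_apply, PiLp.smul_apply, smul_eq_mul]
          field_simp
          linear_combination q0
        · simp only [hx, PiLp.add_apply, PiLp.smul_apply, smul_eq_mul]
          field_simp
          linear_combination q1
    have hx0 : x 0 = (α * a 0 + β * b 0) / (α + β) := by
      simp only [hx, PiLp.add_apply, PiLp.smul_apply, smul_eq_mul]
      field_simp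
    have hx1 : x 1 = (α * a 1 + β * b 1) / (α + β) := by
      simp only [hx, PiLp.add_apply, PiLp.smul_apply, smul_eq_mul]
      field_simp
    have hb : orient p a x = β / (α + β) * O := by
      rw [hOdef]
      unfold orient
      rw [hx0, hx1]
      field_simp
      ring
    have ha : orient b p x = α / (α + β) * O := by
      rw [hOdef]
      unfold orient
      rw [hx0, hx1]
      field_simp
      ring
    have hb' : 0 < orient p a x := by rw [hb]; positivity
    have ha' : 0 < orient b p x := by rw [ha]; positivity
    have := (G.noncross _ hpq _ hab (fun h => (G.ne _ hpa) (congrArg Prod.fst h))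
      (fun h => (G.ne _ hpb) (congrArg Prod.fst h)) x hxpq hxab).2
    rcases this with h | h
    · rw [h, orient_self_right] at hb'
      exact lt_irrefl _ hb'
    · rw [h, orient_self_left] at ha'
      exact lt_irrefl _ ha'

lemma Supported.vertexOpen {S : Finset Pt} {G : PSLG S} {p : Pt} (h : Supported S p) :
    VertexOpen G p (2 * Real.pi / 3) := by
  obtain ⟨l, m, hlm, h⟩ := h
  have hd : (!₂[l, m] : Pt) ≠ 0 := by
    intro h0
    have h1 := congrArg (fun v : Pt => v 0) h0
    have h2 := congrArg (fun v : Pt => v 1) h0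
    simp at h1 h2
    tauto
  refine ⟨!₂[l, m], hd, fun q hpq => ?_⟩
  apply angle_le_of_dotAt hd (sub_ne_zero.2 (G.ne _ hpq).symm)
  have : inner ℝ (!₂[l, m] : Pt) (q - p) = l * (q 0 - p 0) + m * (q 1 - p 1) := by
    rw [PiLp.inner_apply, Fin.sum_univ_two]
    simp [mul_comm]
  rw [this]
  have := h q (G.endpts _ hpq).2
  have : 0 ≤ ‖(!₂[l, m] : Pt)‖ * ‖q - p‖ := by positivity
  linarith

lemma Finset.exists_forall_rel {α : Type*} {R : α → α → Prop} (T : Finset α) (hT : T.Nonempty)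
    (total : ∀ x ∈ T, ∀ y ∈ T, R x y ∨ R y x)
    (trans : ∀ x ∈ T, ∀ y ∈ T, ∀ z ∈ T, R x y → R y z → R x z) :
    ∃ x ∈ T, ∀ y ∈ T, R x y := by
  induction hT using Finset.Nonempty.cons_induction with
  | singleton a => exact ⟨a, by simp, by simpa using total a (by simp) a (by simp)⟩
  | cons a s ha hs ih =>
    obtain ⟨x, hx, h⟩ := ih
      (fun x hx y hy => total x (Finset.mem_cons_of_mem hx) y (Finset.mem_cons_of_mem hy))
      (fun x hx y hy z hz => trans x (Finset.mem_cons_of_mem hx) y (Finset.mem_cons_of_mem hy) z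
        (Finset.mem_cons_of_mem hz))
    have ma : a ∈ Finset.cons a s ha := Finset.mem_cons_self a s
    have mx : x ∈ Finset.cons a s ha := Finset.mem_cons_of_mem hx
    rcases total x mx a ma with hxa | hax
    · refine ⟨x, mx, fun y hy => ?_⟩
      rcases Finset.mem_cons.1 hy with rfl | hy
      · exact hxa
      · exact h y hy
    · refine ⟨a, ma, fun y hy => ?_⟩
      rcases Finset.mem_cons.1 hy with rfl | hy
      · exact (total y ma y ma).elim id id
      · exact trans a ma x mx y (Finset.mem_cons_of_mem hy) hax (h y hy)

lemma cross_trans {x0 x1 y0 y1 z0 z1 : ℝ} (hx : 0 < x0 ∨ x0 = 0 ∧ 0 < x1)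
    (hy : 0 < y0 ∨ y0 = 0 ∧ 0 < y1) (hz : 0 < z0 ∨ z0 = 0 ∧ 0 < z1)
    (h1 : 0 ≤ x0 * y1 - x1 * y0) (h2 : 0 ≤ y0 * z1 - y1 * z0) : 0 ≤ x0 * z1 - x1 * z0 := by
  have e0 : y0 * (x0 * z1 - x1 * z0) = (x0 * y1 - x1 * y0) * z0 + (y0 * z1 - y1 * z0) * x0 := by
    ring
  have hx0 : 0 ≤ x0 := by rcases hx with h | h <;> linarith [h]
  have hz0 : 0 ≤ z0 := by rcases hz with h | h <;> linarith [h]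
  rcases hy with hy | ⟨rfl, hy⟩
  · refine nonneg_of_mul_nonneg_right (a := y0) ?_ hy
    rw [e0]
    positivity
  · have : z0 = 0 := by nlinarith
    subst this
    have : 0 < z1 := by rcases hz with h | h <;> linarith [h]
    simp only [mul_zero, sub_zero]
    positivity

/-- Every nonempty finite set has a point `a` with two hull edges `ab` and `ac`. -/
lemma exists_hull_edges {S : Finset Pt} (hS : 2 ≤ S.card) :
    ∃ a ∈ S, ∃ b ∈ S, ∃ c ∈ S, a ≠ b ∧ a ≠ c ∧ (∀ s ∈ S, 0 ≤ orient a b s) ∧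
      ∀ s ∈ S, 0 ≤ orient c a s := by
  have hne : S.Nonempty := Finset.card_pos.1 (by omega)
  obtain ⟨a, ha, hmin⟩ := S.exists_min_image (fun p => toLex (p 0, p 1)) hne
  have hlex : ∀ s ∈ S.erase a, 0 < s 0 - a 0 ∨ s 0 - a 0 = 0 ∧ 0 < s 1 - a 1 := by
    intro s hs
    obtain ⟨hsa, hs⟩ := Finset.mem_erase.1 hs
    rcases Prod.Lex.le_iff.1 (hmin s hs) with h | ⟨h, h'⟩
    · exact .inl (sub_pos.2 h)
    · refine .inr ⟨sub_eq_zero.2 h.symm, sub_pos.2 (lt_of_le_of_ne h' fun h' => hsa ?_)⟩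
      exact Pt.ext' h.symm h'.symm
  have hT : (S.erase a).Nonempty := by
    rw [← Finset.card_pos, Finset.card_erase_of_mem ha]
    omega
  have tot (x y : Pt) : 0 ≤ orient a x y ∨ 0 ≤ orient a y x := by
    have : orient a y x = - orient a x y := by
      unfold orient
      ring
    rw [this]
    rcases le_total 0 (orient a x y) with h | h
    · exact .inl h
    · exact .inr (by linarith)
  have tr : ∀ x ∈ S.erase a, ∀ y ∈ S.erase a, ∀ z ∈ S.erase a, 0 ≤ orient a x y →
      0 ≤ orient a y z → 0 ≤ orient a x z :=
    fun x hx y hy z hz => cross_trans (hlex x hx) (hlex y hy) (hlex z hz)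
  obtain ⟨b, hb, hb'⟩ := (S.erase a).exists_forall_rel (R := fun x y => 0 ≤ orient a x y) hT
    (fun x _ y _ => tot x y) tr
  obtain ⟨c, hc, hc'⟩ := (S.erase a).exists_forall_rel (R := fun x y => 0 ≤ orient a y x) hT
    (fun x _ y _ => tot y x) (fun x hx y hy z hz h1 h2 => tr z hz y hy x hx h2 h1)
  refine ⟨a, ha, b, Finset.mem_of_mem_erase hb, c, Finset.mem_of_mem_erase hc,
    (Finset.ne_of_mem_erase hb).symm, (Finset.ne_of_mem_erase hc).symm, fun s hs => ?_,
    fun s hs => ?_⟩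
  · by_cases h : s = a
    · rw [h, orient_self_left]
    · exact hb' s (Finset.mem_erase.2 ⟨h, hs⟩)
  · by_cases h : s = a
    · rw [h, orient_self_right]
    · rw [orient_rotate, orient_rotate]
      have := hc' s (Finset.mem_erase.2 ⟨h, hs⟩)
      rwa [← orient_rotate, ← orient_rotate] at this ⊢

/-- Some plane graph on `S` guards every point that is not on the convex hull. -/
def Guardable (S : Finset Pt) : Prop :=
  ∃ G : PSLG S, ∀ p ∈ S, Supported S p ∨ Guarded S G.E p

lemma guardable_of_supported {S : Finset Pt} (h : ∀ p ∈ S, Supported S p) : Guardable S :=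
  ⟨⟨∅, by simp, by simp, by simp, by simp⟩, fun p hp => .inl (h p hp)⟩

lemma filter_card_lt {S : Finset Pt} {u v s : Pt} (hs : s ∈ S) (h : orient u v s < 0) :
    (S.filter fun s => 0 ≤ orient u v s).card < S.card :=
  Finset.card_lt_card (Finset.filter_ssubset.2 ⟨s, hs, not_le.2 h⟩)

/-- Cutting along a line through two hull points. -/
lemma guardable_of_halves {S : Finset Pt} (hS : GenPos S) {u v : Pt} (hu : u ∈ S) (hv : v ∈ S)
    (huv : u ≠ v) (hu' : Supported S u) (hv' : Supported S v)
    (h1 : Guardable (S.filter fun s => 0 ≤ orient u v s))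
    (h2 : Guardable (S.filter fun s => 0 ≤ orient v u s)) : Guardable S := by
  obtain ⟨G₁, hG₁⟩ := h1
  obtain ⟨G₂, hG₂⟩ := h2
  obtain ⟨T, hT1, hT2, -⟩ := exists_triangulation_of_halves hS hu hv huv G₁ G₂
  refine ⟨T, fun p hp => ?_⟩
  rcases lt_trichotomy (orient u v p) 0 with h | h | h
  · have h : 0 < orient v u p := by rw [orient_swap]; linarith
    exact (hG₂ p (Finset.mem_filter.2 ⟨hp, h.le⟩)).imp (hv'.of_half hu' hv hu huv.symm hp h)
      fun hg => hg.of_half.mono hT2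
  · left
    rcases hS.eq_or_eq_of_orient_eq_zero hu hv hp huv h with rfl | rfl
    · exact hu'
    · exact hv'
  · exact (hG₁ p (Finset.mem_filter.2 ⟨hp, h.le⟩)).imp (hu'.of_half hv' hu hv huv hp h)
      fun hg => hg.of_half.mono hT1

/-- Among the points that see `ab` at a wide angle there is one whose triangle with `ab` is
empty. -/
lemma exists_empty_wide_triangle {S : Finset Pt} {a b c p : Pt} (hp : p ∈ S)
    (hpc : p ≠ c) (hpos : ∀ s ∈ S, s ≠ a → s ≠ b → 0 < orient a b s)
    (hposc : ∀ s ∈ S, s ≠ b → s ≠ c → 0 < orient b c s) (hpa : p ≠ a) (hpb : p ≠ b)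
    (hang : √3 * dotAt p a b + orient a b p ≤ 0) :
    ∃ d ∈ S, d ≠ a ∧ d ≠ b ∧ d ≠ c ∧ √3 * dotAt d a b + orient a b d ≤ 0 ∧
      ∀ s ∈ S, 0 ≤ orient a b s → 0 ≤ orient b d s → 0 ≤ orient d a s →
        s = a ∨ s = b ∨ s = d := by
  let C := S.filter fun s => s ≠ a ∧ s ≠ b ∧ s ≠ c ∧ √3 * dotAt s a b + orient a b s ≤ 0
  obtain ⟨d, hd, hmin⟩ := C.exists_min_image (fun s => orient a b s)
    ⟨p, Finset.mem_filter.2 ⟨hp, hpa, hpb, hpc, hang⟩⟩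
  obtain ⟨hdS, hda, hdb, hdc, hdang⟩ := Finset.mem_filter.1 hd
  refine ⟨d, hdS, hda, hdb, hdc, hdang, fun s hs s1 s2 s3 => ?_⟩
  by_contra! hne
  obtain ⟨hsa, hsb, hsd⟩ := hne
  have hO := hpos d hdS hda hdb
  have hsc : s ≠ c := by
    rintro rfl
    have := hposc d hdS hdb hdc
    have := orient_swap b s d
    have := orient_rotate s b d
    have := orient_rotate b d s
    linarith
  set O := orient a b d with hOdef
  have hsum : orient b d s + orient d a s + orient a b s = O := by
    rw [hOdef]
    unfold orient
    ring
  have h0 : s 0 = orient b d s / O * a 0 + orient d a s / O * b 0 + orient a b s / O * d 0 := by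
    have := orient_mul_affine a b d s 1 0 0
    field_simp
    linarith
  have h1 : s 1 = orient b d s / O * a 1 + orient d a s / O * b 1 + orient a b s / O * d 1 := by
    have := orient_mul_affine a b d s 0 1 0
    field_simp
    linarith
  have hsang := dotAt_convex (div_nonneg s2 hO.le) (div_nonneg s3 hO.le) (div_nonneg s1 hO.le)
    (by field_simp; exact hsum) h0 h1 (Real.sqrt_nonneg 3) hdang
  have hle := hmin s (Finset.mem_filter.2 ⟨hs, hsa, hsb, hsc, hsang⟩)
  have z1 : orient b d s = 0 := by linarith
  have z2 : orient d a s = 0 := by linarith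
  have z3 : orient a b s = O := by linarith
  rw [z1, z2, z3, div_self hO.ne', zero_div] at h0 h1
  exact hsd (Pt.ext' (by linarith) (by linarith))

/-- A triangle `abc` with an interior point `d` seeing `ab` at a wide angle, such that `abd` is
empty, splits into the triangles `bcd` and `cad`. -/
lemma guardable_of_empty_triangle {S : Finset Pt} (hS : GenPos S) {a b c d : Pt} (ha : a ∈ S)
    (hb : b ∈ S) (hc : c ∈ S) (hd : d ∈ S) (hab : a ≠ b) (hbc : b ≠ c) (hca : c ≠ a)
    (hda : d ≠ a) (hdb : d ≠ b) (hdc : d ≠ c) (h1 : ∀ s ∈ S, 0 ≤ orient a b s)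
    (h2 : ∀ s ∈ S, 0 ≤ orient b c s) (h3 : ∀ s ∈ S, 0 ≤ orient c a s)
    (hang : √3 * dotAt d a b + orient a b d ≤ 0)
    (hempty : ∀ s ∈ S, 0 ≤ orient a b s → 0 ≤ orient b d s → 0 ≤ orient d a s →
        s = a ∨ s = b ∨ s = d)
    (ih : ∀ T ⊆ S, T.card < S.card → Guardable T) : Guardable S := by
  have d1 := hS.orient_pos ha hb hd hab hda hdb (h1 d hd)
  have d2 := hS.orient_pos hb hc hd hbc hdb hdc (h2 d hd)
  have d3 := hS.orient_pos hc ha hd hca hdc hda (h3 d hd)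
  have fa : orient c d a < 0 := by
    have := orient_rotate c d a
    have := orient_rotate a c d
    have := orient_swap c a d
    linarith
  have fb : orient d c b < 0 := by
    have := orient_rotate d c b
    have := orient_rotate b d c
    have := orient_swap b c d
    have := orient_swap d c b
    have := orient_rotate b c d
    have := orient_rotate c d b
    linarith
  obtain ⟨G₁, hG₁⟩ := ih _ (Finset.filter_subset _ S) (filter_card_lt ha fa)
  obtain ⟨G₂, hG₂⟩ := ih _ (Finset.filter_subset _ S) (filter_card_lt hb fb)
  obtain ⟨T₁, hT₁, hT₁'⟩ := G₁.exists_triangulation_extending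
  obtain ⟨T₂, hT₂, hT₂'⟩ := G₂.exists_triangulation_extending
  obtain ⟨T, hT1, hT2, hT⟩ := exists_triangulation_of_halves hS hc hd hdc.symm T₁ T₂
  have in₁ : ∀ s ∈ S, 0 ≤ orient c d s → 0 ≤ orient d b s := by
    intro s hs hcd
    by_contra! hneg
    have hbd : 0 < orient b d s := by rw [orient_swap]; linarith
    have e : orient b c d * orient d a s + orient c a d * orient d b s
        + orient a b d * orient d c s = 0 := by
      unfold orient
      ring
    have hda' : 0 ≤ orient d a s := by
      rw [orient_swap c d] at e
      refine nonneg_of_mul_nonneg_right (a := orient b c d) ?_ d2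
      nlinarith [mul_pos d3 (neg_pos.2 hneg), mul_nonneg d1.le hcd]
    rcases hempty s hs (h1 s hs) hbd.le hda' with rfl | rfl | rfl
    · linarith
    · linarith [orient_self_left s d]
    · linarith [orient_self_right b s]
  have in₂ : ∀ s ∈ S, 0 ≤ orient d c s → 0 ≤ orient a d s := by
    intro s hs hcd
    by_contra! hneg
    have hda' : 0 < orient d a s := by rw [orient_swap]; linarith
    have e : orient b c d * orient d a s + orient c a d * orient d b s
        + orient a b d * orient d c s = 0 := by
      unfold orient
      ring
    have hbd : 0 ≤ orient b d s := by
      rw [orient_swap b d] at e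
      refine nonneg_of_mul_nonneg_right (a := orient c a d) ?_ d3
      nlinarith [mul_pos d2 hda', mul_nonneg d1.le hcd]
    rcases hempty s hs (h1 s hs) hbd hda'.le with rfl | rfl | rfl
    · linarith [orient_self_right d s]
    · linarith
    · linarith [orient_self_left s a]
  have mem₁ {s : Pt} (hs : s ∈ S) (h : 0 ≤ orient c d s) :
      s ∈ S.filter fun s => 0 ≤ orient c d s := Finset.mem_filter.2 ⟨hs, h⟩
  have mem₂ {s : Pt} (hs : s ∈ S) (h : 0 ≤ orient d c s) :
      s ∈ S.filter fun s => 0 ≤ orient d c s := Finset.mem_filter.2 ⟨hs, h⟩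
  have fa' : 0 < orient d c a := by rw [orient_swap]; linarith
  have fb' : 0 < orient c d b := by rw [orient_swap]; linarith
  have edb : (d, b) ∈ T.E := hT1 (hT₁'.mem_of_orient_nonneg (hS.mono (Finset.filter_subset _ _))
    (mem₁ hd (orient_self_right c d).ge) (mem₁ hb fb'.le) hdb fun s hs =>
      in₁ s (Finset.mem_filter.1 hs).1 (Finset.mem_filter.1 hs).2)
  have ead : (a, d) ∈ T.E := hT2 (hT₂'.mem_of_orient_nonneg (hS.mono (Finset.filter_subset _ _))
    (mem₂ ha fa'.le) (mem₂ hd (orient_self_left d c).ge) hda.symm fun s hs =>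
      in₂ s (Finset.mem_filter.1 hs).1 (Finset.mem_filter.1 hs).2)
  have eab : (a, b) ∈ T.E := hT.mem_of_orient_nonneg hS ha hb hab h1
  refine ⟨T, fun p hp => ?_⟩
  by_cases hpa : p = a
  · exact .inl (supported_of_orient_nonneg hab h1 (hpa ▸ orient_self_left a b))
  by_cases hpb : p = b
  · exact .inl (supported_of_orient_nonneg hab h1 (hpb ▸ orient_self_right a b))
  by_cases hpc : p = c
  · exact .inl (supported_of_orient_nonneg hbc h2 (hpc ▸ orient_self_right b c))
  right
  by_cases hpd : p = d
  · subst hpd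
    exact ⟨a, b, T.symm _ ead, edb, eab, d1, hang, hempty⟩
  rcases le_total 0 (orient c d p) with hcd | hcd
  · have hg := (hG₁ p (mem₁ hp hcd)).resolve_left <| not_supported_of_orient_pos
      (mem₁ hb fb'.le) (mem₁ hc (orient_self_left c d).ge) (mem₁ hd (orient_self_right c d).ge)
      (hS.orient_pos hb hc hp hbc hpb hpc (h2 p hp))
      (hS.orient_pos hc hd hp hdc.symm hpc hpd hcd)
      (hS.orient_pos hd hb hp hdb hpd hpb (in₁ p hp hcd))
    exact hg.of_half.mono (hT₁.trans hT1)
  · have hdc' : 0 ≤ orient d c p := by rw [orient_swap]; linarith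
    have hg := (hG₂ p (mem₂ hp hdc')).resolve_left <| not_supported_of_orient_pos
      (mem₂ hc (orient_self_right d c).ge) (mem₂ ha fa'.le) (mem₂ hd (orient_self_left d c).ge)
      (hS.orient_pos hc ha hp hca hpc hpa (h3 p hp))
      (hS.orient_pos ha hd hp hda.symm hpa hpd (in₂ p hp hdc'))
      (hS.orient_pos hd hc hp hdc hpd hpc hdc')
    exact hg.of_half.mono (hT₂.trans hT2)

/-- The case of a triangular convex hull `abc`, given a point that sees `ab` at a wide angle. -/
lemma guardable_of_wide_angle {S : Finset Pt} (hS : GenPos S) {a b c p : Pt} (ha : a ∈ S)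
    (hb : b ∈ S) (hc : c ∈ S) (hp : p ∈ S) (hab : a ≠ b) (hbc : b ≠ c) (hca : c ≠ a)
    (hpa : p ≠ a) (hpb : p ≠ b) (hpc : p ≠ c) (h1 : ∀ s ∈ S, 0 ≤ orient a b s)
    (h2 : ∀ s ∈ S, 0 ≤ orient b c s) (h3 : ∀ s ∈ S, 0 ≤ orient c a s)
    (hang : √3 * dotAt p a b + orient a b p ≤ 0)
    (ih : ∀ T ⊆ S, T.card < S.card → Guardable T) : Guardable S := by
  obtain ⟨d, hd, hda, hdb, hdc, hdang, hempty⟩ := exists_empty_wide_triangle hp hpc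
    (fun s hs hsa hsb => hS.orient_pos ha hb hs hab hsa hsb (h1 s hs))
    (fun s hs hsb hsc => hS.orient_pos hb hc hs hbc hsb hsc (h2 s hs)) hpa hpb hang
  exact guardable_of_empty_triangle hS ha hb hc hd hab hbc hca hda hdb hdc h1 h2 h3 hdang hempty ih

lemma GenPos.guardable {S : Finset Pt} (hS : GenPos S) : Guardable S := by
  induction hn : S.card using Nat.strong_induction_on generalizing S with
  | _ n ih =>
  subst hn
  have ih' : ∀ T ⊆ S, T.card < S.card → Guardable T :=
    fun T hT hlt => ih _ hlt (hS.mono hT) rfl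
  rcases lt_or_ge S.card 2 with hcard | hcard
  · refine guardable_of_supported fun p hp => ⟨1, 0, by simp, fun q hq => ?_⟩
    rw [Finset.card_le_one.1 (by omega) q hq p hp]
    simp
  obtain ⟨a, ha, b, hb, c, hc, hab, hac, h1, h3⟩ := exists_hull_edges hcard
  by_cases hbc : b = c
  · subst hbc
    exact guardable_of_supported fun p hp => supported_of_orient_nonneg hab h1
      (by linarith [h1 p hp, h3 p hp, orient_swap a b p])
  have sb : Supported S b := supported_of_orient_nonneg hab h1 (orient_self_right a b)
  have sc : Supported S c := supported_of_orient_nonneg hac.symm h3 (orient_self_left c a)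
  by_cases h2 : ∀ s ∈ S, 0 ≤ orient b c s
  · by_cases hall : ∃ p ∈ S, p ≠ a ∧ p ≠ b ∧ p ≠ c
    · obtain ⟨p, hp, hpa, hpb, hpc⟩ := hall
      rcases exists_wide_angle (hS.orient_pos ha hb hp hab hpa hpb (h1 p hp))
        (hS.orient_pos hb hc hp hbc hpb hpc (h2 p hp))
        (hS.orient_pos hc ha hp hac.symm hpc hpa (h3 p hp)) with hang | hang | hang
      · exact guardable_of_wide_angle hS ha hb hc hp hab hbc hac.symm hpa hpb hpc h1 h2 h3 hang ih'
      · exact guardable_of_wide_angle hS hb hc ha hp hbc hac.symm hab hpb hpc hpa h2 h3 h1 hang ih'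
      · exact guardable_of_wide_angle hS hc ha hb hp hac.symm hab hbc hpc hpa hpb h3 h1 h2 hang ih'
    · push Not at hall
      refine guardable_of_supported fun p hp => ?_
      by_cases hpa : p = a
      · exact supported_of_orient_nonneg hab h1 (hpa ▸ orient_self_left a b)
      by_cases hpb : p = b
      · exact hpb ▸ sb
      · exact hall p hp hpa hpb ▸ sc
  · push Not at h2
    obtain ⟨s, hs, hneg⟩ := h2
    have hapos : orient c b a < 0 := by
      have := hS.orient_pos ha hb hc hab hac.symm (Ne.symm hbc) (h1 c hc)
      have := orient_rotate a b c
      have := orient_swap b c a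
      linarith
    exact guardable_of_halves hS hb hc hbc sb sc
      (ih' _ (Finset.filter_subset _ _) (filter_card_lt hs hneg))
      (ih' _ (Finset.filter_subset _ _) (filter_card_lt ha hapos))

/-- Every finite point set in general position with at least three points admits a
`2π/3`-open triangulation. -/
theorem stmt6 (S : Finset Pt) (hgp : GenPos S) (h3 : 3 ≤ S.card) :
    ∃ T : PSLG S, T.IsTriangulation ∧ T.IsPhiOpen (2 * Real.pi / 3) := by
  obtain ⟨G, hG⟩ := hgp.guardable
  obtain ⟨T, hGT, hT⟩ := G.exists_triangulation_extending
  exact ⟨T, hT, fun p hp => (hG p hp).elim Supported.vertexOpen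
    fun h => (h.mono hGT).vertexOpen⟩
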